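/- Let k, ℓ ≥ 3, let λ = (k, 1^{ℓ−1}), and let n ≥ ℓ be the number of variables. Then the coefficient of the Schur polynomial s_{(k^2, 2^{ℓ−2})} in the Schur expansion of (s_λ^{(1)})^2 − s_λ · s_λ^{(2)} equals (n + k − 1)(k + ℓ − 2) + (n + 1 − ℓ)^2, which is positive. -/

import Mathlib

open MvPolynomial

noncomputable section

/-- The complete homogeneous symmetric polynomial in `n` variables, indexed by an
integer (by convention it is `0` for negative indices). -/
def hInt (n : ℕ) (k : ℤ) : MvPolynomial (Fin n) ℚ :=
  if 0 ≤ k then MvPolynomial.hsymm (Fin n) ℚ k.toNat else 0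

/-- The number of (nonzero) parts of a partition `lam : ℕ → ℕ` (parts are indexed
starting from `0`). -/
def partLen (lam : ℕ → ℕ) : ℕ := sInf {N | lam N = 0}

/-- A partition, recorded as a weakly decreasing, eventually zero function `ℕ → ℕ`
listing its parts (indexed starting from `0`). -/
def IsPartition (lam : ℕ → ℕ) : Prop := Antitone lam ∧ ∃ N, ∀ i, N ≤ i → lam i = 0

/-- The Schur polynomial of a partition in `n` variables, via the Jacobi-Trudi identity
`s_lam = det (h_{lam_i + j - i})`. -/
def schur (n : ℕ) (lam : ℕ → ℕ) : MvPolynomial (Fin n) ℚ :=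
  (Matrix.of fun i j : Fin (partLen lam) =>
    hInt n ((lam i : ℤ) + ((j : ℕ) : ℤ) - ((i : ℕ) : ℤ))).det

/-- The `i`-th derived polynomial `p^{(i)}` of `p`, defined by the identity
`p (x₁ + t, …, xₙ + t) = ∑ i, t^i • p^{(i)} (x₁, …, xₙ)`: substituting `X j + t` for each
variable `X j` yields a polynomial in `t` whose `t^i`-coefficient is `p^{(i)}`. -/
def derived (n i : ℕ) (p : MvPolynomial (Fin n) ℚ) : MvPolynomial (Fin n) ℚ :=
  (MvPolynomial.aeval
    (fun j : Fin n => (Polynomial.C (X j) + Polynomial.X : Polynomial (MvPolynomial (Fin n) ℚ)))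
    p).coeff i

/-- A symmetric polynomial is Schur positive if it is a linear combination of Schur
polynomials (of partitions) with non-negative coefficients. -/
def SchurPositive (n : ℕ) (f : MvPolynomial (Fin n) ℚ) : Prop :=
  ∃ (S : Finset (ℕ → ℕ)) (c : (ℕ → ℕ) → ℚ),
    (∀ μ ∈ S, IsPartition μ) ∧ (∀ μ ∈ S, 0 ≤ c μ) ∧ f = ∑ μ ∈ S, c μ • schur n μ


theorem multiset_prod_map_X {σ : Type*} [DecidableEq σ] (s : Multiset σ) :
    (s.map X).prod = monomial (R := ℚ) (Multiset.toFinsupp s) 1 := by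
  induction s using Multiset.induction with
  | empty => simp
  | cons a s ih =>
    rw [Multiset.map_cons, Multiset.prod_cons, ih, ← Multiset.singleton_add, map_add,
      Multiset.toFinsupp_singleton, X, monomial_mul, one_mul]

theorem coeff_hsymm {σ : Type*} [Fintype σ] [DecidableEq σ] (r : ℕ) (κ : σ →₀ ℕ) :
    coeff κ (hsymm σ ℚ r) = if κ.degree = r then 1 else 0 := by
  have hsum : coeff κ (hsymm σ ℚ r) =
      ∑ s : Sym σ r, if Multiset.toFinsupp s.toMultiset = κ then (1 : ℚ) else 0 := by
    rw [hsymm, coeff_sum]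
    refine Finset.sum_congr rfl fun s _ => ?_
    rw [← coeff_monomial, ← multiset_prod_map_X]
    rfl
  rw [hsum]
  split_ifs with h
  · have hc : (Finsupp.toMultiset κ).card = r := by
      rw [Finsupp.card_toMultiset, ← h]; rfl
    rw [Finset.sum_eq_single (Sym.mk (Finsupp.toMultiset κ) hc)]
    · simp [Sym.toMultiset]
    · intro s _ hs
      rw [if_neg]
      rintro rfl
      apply hs
      apply Sym.coe_injective
      exact (Multiset.toFinsupp_toMultiset _).symm
    · simp
  · refine Finset.sum_eq_zero fun s _ => if_neg ?_
    rintro rfl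
    apply h
    have h1 : (Finsupp.toMultiset (Multiset.toFinsupp s.toMultiset)).card =
        (Multiset.toFinsupp s.toMultiset).degree := Finsupp.card_toMultiset _
    rw [← h1, Multiset.toFinsupp_toMultiset]
    exact s.2

theorem coeff_hsymm_mul_esymm {σ : Type*} [Fintype σ] [DecidableEq σ] (k r : ℕ) (κ : σ →₀ ℕ) :
    coeff κ (hsymm σ ℚ k * esymm σ ℚ r) =
      if κ.degree = k + r then ((κ.support.card.choose r : ℕ) : ℚ) else 0 := by
  have hle (t : Finset σ) : (∑ i ∈ t, Finsupp.single i 1) ≤ κ ↔ t ⊆ κ.support := by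
    constructor
    · intro h i hi
      have := h i
      simp [Finsupp.finsetSum_apply, Finsupp.single_apply, hi] at this
      simp; omega
    · intro h i
      simp only [Finsupp.finsetSum_apply, Finsupp.single_apply, Finset.sum_ite_eq']
      split_ifs with hi
      · have := h hi
        simp at this; omega
      · simp
  have hdeg (t : Finset σ) : (∑ i ∈ t, Finsupp.single i 1).degree = t.card := by
    simp [map_sum]
  simp only [esymm_eq_sum_monomial, Finset.mul_sum, coeff_sum, coeff_mul_monomial', coeff_hsymm,
    mul_one, hle]
  rw [← Finset.sum_filter]
  have hf : (Finset.powersetCard r (Finset.univ : Finset σ)).filter (fun t => t ⊆ κ.support) =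
      Finset.powersetCard r κ.support := by
    ext t; simp [Finset.mem_powersetCard]; tauto
  rw [hf]
  have : ∀ t ∈ Finset.powersetCard r κ.support,
      (if (κ - ∑ i ∈ t, Finsupp.single i 1).degree = k then (1 : ℚ) else 0) =
      if κ.degree = k + r then 1 else 0 := by
    intro t ht
    rw [Finset.mem_powersetCard] at ht
    have h1 : (κ - ∑ i ∈ t, Finsupp.single i 1).degree + r = κ.degree := by
      rw [← ht.2, ← hdeg t, ← map_add, tsub_add_cancel_of_le ((hle t).2 ht.1)]
    congr 1
    apply propext
    omega
  rw [Finset.sum_congr rfl this]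
  split_ifs <;> simp

/-- The Jacobi-Trudi determinant of size `N`. -/
def jacobiTrudi (n N : ℕ) (μ : ℕ → ℕ) : MvPolynomial (Fin n) ℚ :=
  (Matrix.of fun i j : Fin N => hInt n ((μ i : ℤ) + ((j : ℕ) : ℤ) - ((i : ℕ) : ℤ))).det

/-- The parts of the hook partition `(k, 1^(l-1))`. -/
def hookParts (k l : ℕ) : ℕ → ℕ := fun i => if i = 0 then k else if i < l then 1 else 0

theorem hInt_natCast (n r : ℕ) : hInt n r = hsymm (Fin n) ℚ r := by
  simp [hInt]

theorem hInt_of_neg (n : ℕ) {z : ℤ} (hz : z < 0) : hInt n z = 0 := by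
  simp [hInt, hz]

theorem hInt_zero (n : ℕ) : hInt n 0 = 1 := by
  simp [hInt]

theorem partLen_eq {μ : ℕ → ℕ} {L : ℕ} (h0 : μ L = 0) (h : ∀ i < L, μ i ≠ 0) :
    partLen μ = L := by
  apply le_antisymm
  · exact Nat.sInf_le h0
  · by_contra! hlt
    exact h _ hlt (Nat.sInf_mem (s := {N | μ N = 0}) ⟨L, h0⟩)

theorem partLen_hookParts (k l : ℕ) : partLen (hookParts (k + 1) (l + 1)) = l + 1 := by
  apply partLen_eq
  · simp [hookParts]
  · intro i hi
    simp only [hookParts]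
    split_ifs <;> simp

theorem schur_hookParts (n k l : ℕ) :
    schur n (hookParts (k + 1) (l + 1)) = jacobiTrudi n (l + 1) (hookParts (k + 1) (l + 1)) := by
  have h (N : ℕ) (hN : partLen (hookParts (k + 1) (l + 1)) = N) :
      schur n (hookParts (k + 1) (l + 1)) = jacobiTrudi n N (hookParts (k + 1) (l + 1)) := by
    subst hN; rfl
  exact h _ (partLen_hookParts k l)

theorem jacobiTrudi_hookParts_one (n k : ℕ) :
    jacobiTrudi n 1 (hookParts k 1) = hsymm (Fin n) ℚ k := by
  simp [jacobiTrudi, hookParts, hInt_natCast]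

theorem jacobiTrudi_hookParts_succ (n k m : ℕ) :
    jacobiTrudi n (m + 2) (hookParts k (m + 2)) =
      hsymm (Fin n) ℚ k * jacobiTrudi n (m + 1) (hookParts 1 (m + 1)) -
        jacobiTrudi n (m + 1) (hookParts (k + 1) (m + 1)) := by
  rw [jacobiTrudi, Matrix.det_succ_column_zero, Fin.sum_univ_succ, Fin.sum_univ_succ,
    Finset.sum_eq_zero]
  · have h1 : ((Matrix.of fun i j : Fin (m + 2) =>
        hInt n ((hookParts k (m + 2) i : ℤ) + ((j : ℕ) : ℤ) - ((i : ℕ) : ℤ))).submatrix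
          (Fin.succAbove 0) Fin.succ).det = jacobiTrudi n (m + 1) (hookParts 1 (m + 1)) := by
      rw [jacobiTrudi]
      congr 1
      ext1 i j
      simp only [Matrix.submatrix_apply, Matrix.of_apply, hookParts]
      congr 1
      have := i.2
      cases i using Fin.cases with
      | zero => simp; ring
      | succ i =>
        have := i.2
        simp [show (i : ℕ) + 1 < m + 1 by omega]
        ring
    have h2 : ((Matrix.of fun i j : Fin (m + 2) =>
        hInt n ((hookParts k (m + 2) i : ℤ) + ((j : ℕ) : ℤ) - ((i : ℕ) : ℤ))).submatrix
          (Fin.succAbove (Fin.succ 0)) Fin.succ).det =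
            jacobiTrudi n (m + 1) (hookParts (k + 1) (m + 1)) := by
      rw [jacobiTrudi]
      congr 1
      ext1 i j
      simp only [Matrix.submatrix_apply, Matrix.of_apply, hookParts]
      congr 1
      have := i.2
      cases i using Fin.cases with
      | zero => simp; ring
      | succ i =>
        have := i.2
        rw [Fin.succAbove_of_le_castSucc _ _ (by rw [Fin.le_def]; simp)]
        simp [show (i : ℕ) + 1 < m + 1 by omega]
        ring
    rw [h1, h2]
    simp [hookParts, hInt_natCast, hInt_zero]
    ring
  · intro i _
    simp only [Matrix.of_apply, hookParts]
    rw [hInt_of_neg]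
    · simp
    · have := i.2
      simp
      omega

theorem card_support_le_degree {σ : Type*} (κ : σ →₀ ℕ) : κ.support.card ≤ κ.degree := by
  rw [Finset.card_eq_sum_ones]
  refine Finset.sum_le_sum fun i hi => ?_
  have := Finsupp.mem_support_iff.1 hi
  omega

theorem card_support_pos {σ : Type*} {κ : σ →₀ ℕ} (h : 0 < κ.degree) : 0 < κ.support.card := by
  rw [Finset.card_pos, Finsupp.support_nonempty_iff]
  rintro rfl
  simp at h

theorem jacobiTrudi_hookParts_one_left (n m : ℕ)
    (h : ∀ (k : ℕ) (κ : Fin n →₀ ℕ), coeff κ (jacobiTrudi n (m + 1) (hookParts (k + 1) (m + 1))) =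
      if κ.degree = k + m + 1 then (((κ.support.card - 1).choose m : ℕ) : ℚ) else 0) :
    jacobiTrudi n (m + 1) (hookParts 1 (m + 1)) = esymm (Fin n) ℚ (m + 1) := by
  ext κ
  have := coeff_hsymm_mul_esymm 0 (m + 1) κ
  rw [hsymm_zero, one_mul] at this
  rw [this, h 0 κ]
  simp only [zero_add]
  split_ifs with hd
  · obtain ⟨s, hs⟩ := Nat.exists_eq_succ_of_ne_zero (card_support_pos (κ := κ) (by omega)).ne'
    have hle := card_support_le_degree κ
    rw [hs, Nat.succ_sub_one, Nat.succ_eq_add_one, Nat.choose_succ_succ,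
      Nat.choose_eq_zero_of_lt (k := m + 1) (by omega), add_zero]
  · rfl

theorem coeff_jacobiTrudi_hookParts (n k m : ℕ) (κ : Fin n →₀ ℕ) :
    coeff κ (jacobiTrudi n (m + 1) (hookParts (k + 1) (m + 1))) =
      if κ.degree = k + m + 1 then (((κ.support.card - 1).choose m : ℕ) : ℚ) else 0 := by
  induction m generalizing k κ with
  | zero => simp [jacobiTrudi_hookParts_one, coeff_hsymm]
  | succ m ih =>
    rw [jacobiTrudi_hookParts_succ, jacobiTrudi_hookParts_one_left n m ih, coeff_sub,
      coeff_hsymm_mul_esymm, ih]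
    have h : k + 1 + (m + 1) = k + (m + 1) + 1 := by ring
    have h' : k + 1 + m + 1 = k + (m + 1) + 1 := by ring
    rw [h, h']
    split_ifs with hd
    · obtain ⟨s, hs⟩ := Nat.exists_eq_succ_of_ne_zero (card_support_pos (κ := κ) (by omega)).ne'
      rw [hs, Nat.succ_sub_one, Nat.succ_eq_add_one, Nat.choose_succ_succ]
      push_cast
      ring
    · simp

theorem derivative_aeval_translate (n : ℕ) (p : MvPolynomial (Fin n) ℚ) :
    (aeval (fun j : Fin n =>
      (Polynomial.C (X j) + Polynomial.X : Polynomial (MvPolynomial (Fin n) ℚ))) p).derivative =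
    aeval (fun j : Fin n =>
      (Polynomial.C (X j) + Polynomial.X : Polynomial (MvPolynomial (Fin n) ℚ)))
        (∑ i, pderiv i p) := by
  induction p using MvPolynomial.induction_on with
  | C a =>
    simp [MvPolynomial.algebraMap_eq, Polynomial.algebraMap_apply]
  | add p q hp hq => simp only [map_add, hp, hq, Finset.sum_add_distrib]
  | mul_X p j hp =>
    have h1 : ∑ i, pderiv i (p * X j) = (∑ i, pderiv i p) * X j + p := by
      simp only [pderiv_mul, Finset.sum_add_distrib, Finset.sum_mul, pderiv_X, ← Finset.mul_sum]
      congr 1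
      simp [Pi.single_apply]
    rw [map_mul, Polynomial.derivative_mul, hp, h1, map_add, map_mul]
    simp

theorem derived_zero (n : ℕ) (p : MvPolynomial (Fin n) ℚ) : derived n 0 p = p := by
  rw [derived, Polynomial.coeff_zero_eq_eval_zero]
  induction p using MvPolynomial.induction_on with
  | C a => simp [MvPolynomial.algebraMap_eq, Polynomial.algebraMap_apply]
  | add p q hp hq => rw [map_add, Polynomial.eval_add, hp, hq]
  | mul_X p j hp => rw [map_mul, Polynomial.eval_mul, hp]; simp

theorem derived_succ (n i : ℕ) (p : MvPolynomial (Fin n) ℚ) :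
    derived n (i + 1) p * (i + 1) = derived n i (∑ j, pderiv j p) := by
  rw [derived, derived, ← derivative_aeval_translate, Polynomial.coeff_derivative]

theorem derived_one (n : ℕ) (p : MvPolynomial (Fin n) ℚ) :
    derived n 1 p = ∑ j, pderiv j p := by
  simpa [derived_zero] using derived_succ n 0 p

theorem derived_two (n : ℕ) (p : MvPolynomial (Fin n) ℚ) :
    derived n 2 p = (1 / 2 : ℚ) • ∑ i, pderiv i (∑ j, pderiv j p) := by
  have h := derived_succ n 1 p
  rw [derived_one] at h
  rw [← h, smul_eq_C_mul]
  have h2 : (C (1 / 2 : ℚ) : MvPolynomial (Fin n) ℚ) * 2 = 1 := by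
    rw [show (2 : MvPolynomial (Fin n) ℚ) = C 2 from rfl, ← C_mul]
    norm_num
  push_cast
  linear_combination (-derived n 2 p) * h2

theorem coeff_schur_hookParts (n k m : ℕ) (κ : Fin n →₀ ℕ) :
    coeff κ (schur n (hookParts (k + 1) (m + 1))) =
      if κ.degree = k + m + 1 then (((κ.support.card - 1).choose m : ℕ) : ℚ) else 0 := by
  rw [schur_hookParts, coeff_jacobiTrudi_hookParts]

theorem sum_pderiv_schur_hookParts (n k m : ℕ) :
    ∑ i, pderiv i (schur n (hookParts (k + 2) (m + 2))) =
      ((n : ℚ) + k + 1) • schur n (hookParts (k + 1) (m + 2)) +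
        ((n : ℚ) - m - 1) • schur n (hookParts (k + 2) (m + 1)) := by
  ext κ
  simp only [coeff_sum, coeff_pderiv, coeff_add, coeff_smul, coeff_schur_hookParts, smul_eq_mul,
    map_add, Finsupp.degree_single]
  by_cases hd : κ.degree = k + m + 2
  · rw [if_pos (by omega), if_pos (by omega)]
    have hsupp (i : Fin n) : (κ + Finsupp.single i 1).support = insert i κ.support := by
      ext j
      by_cases h : j = i <;> simp [h, eq_comm]
    obtain ⟨t, ht⟩ := Nat.exists_eq_succ_of_ne_zero (card_support_pos (κ := κ) (by omega)).ne'
    have hterm (i : Fin n) : (if κ.degree + 1 = k + 1 + (m + 1) + 1 then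
        ((((κ + Finsupp.single i 1).support.card - 1).choose (m + 1) : ℕ) : ℚ) else 0) *
          ((κ i : ℚ) + 1) =
        (t.choose (m + 1) : ℚ) * κ i + ((t + 1).choose (m + 1) : ℚ) -
          if i ∈ κ.support then (t.choose m : ℚ) else 0 := by
      rw [if_pos (by omega), hsupp]
      split_ifs with hi
      · rw [Finset.insert_eq_of_mem hi, ht, Nat.succ_sub_one, Nat.choose_succ_succ]
        push_cast
        ring
      · rw [Finset.card_insert_of_notMem hi, ht]
        simp only [Finsupp.mem_support_iff, not_not] at hi
        simp [hi]
    rw [Finset.sum_congr rfl fun i _ => hterm i]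
    have hsum : ∑ i, (κ i : ℚ) = k + m + 2 := by
      rw [← Nat.cast_sum, ← Finsupp.degree_eq_sum, hd]
      push_cast
      ring
    rw [Finset.sum_sub_distrib, Finset.sum_add_distrib, ← Finset.mul_sum, hsum, ← Finset.sum_filter,
      Finset.sum_const, Finset.sum_const, Finset.filter_mem_eq_inter, Finset.univ_inter, ht]
    have hch : (t.choose (m + 1) : ℚ) * (m + 1) = t.choose m * (t - m) := by
      rcases le_or_gt m t with hmt | hmt
      · rw [← Nat.cast_sub hmt]
        exact_mod_cast Nat.choose_succ_right_eq t m
      · simp [Nat.choose_eq_zero_of_lt hmt, Nat.choose_eq_zero_of_lt (Nat.lt_succ_of_lt hmt)]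
    rw [Nat.succ_sub_one, Nat.choose_succ_succ]
    simp only [Finset.card_univ, Fintype.card_fin, nsmul_eq_mul]
    push_cast
    linear_combination hch
  · rw [if_neg (by omega), if_neg (by omega)]
    simp only [mul_zero, add_zero]
    exact Finset.sum_eq_zero fun i _ => by rw [if_neg (by omega), zero_mul]

theorem isSymmetric_jacobiTrudi (n N : ℕ) (μ : ℕ → ℕ) : (jacobiTrudi n N μ).IsSymmetric := by
  intro e
  have hh (z : ℤ) : rename e (hInt n z) = hInt n z := by
    rw [hInt]
    split_ifs
    · exact hsymm_isSymmetric _ _ _ e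
    · simp
  rw [jacobiTrudi, AlgHom.map_det]
  congr 1
  ext1 i j
  simp [hh]

theorem isSymmetric_schur (n : ℕ) (μ : ℕ → ℕ) : (schur n μ).IsSymmetric :=
  isSymmetric_jacobiTrudi n (partLen μ) μ

theorem jacobiTrudi_succ {n N : ℕ} {μ : ℕ → ℕ} (h : μ N = 0) :
    jacobiTrudi n (N + 1) μ = jacobiTrudi n N μ := by
  rw [jacobiTrudi, Matrix.det_succ_row _ (Fin.last N), Fin.sum_univ_castSucc, Finset.sum_eq_zero]
  · simp only [Matrix.of_apply, Fin.val_last, h, Fin.succAbove_last, Nat.cast_zero]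
    rw [jacobiTrudi]
    simp [hInt_zero, ← two_mul, pow_mul]
    rfl
  · intro j _
    have := j.2
    simp only [Matrix.of_apply, Fin.val_last, h, Fin.val_castSucc]
    rw [hInt_of_neg n (by push_cast; omega)]
    simp

theorem IsPartition.eq_zero {μ : ℕ → ℕ} (hμ : IsPartition μ) {i : ℕ} (hi : partLen μ ≤ i) :
    μ i = 0 := by
  obtain ⟨N, hN⟩ := hμ.2
  have h0 : μ (partLen μ) = 0 := Nat.sInf_mem (s := {N | μ N = 0}) ⟨N, hN N le_rfl⟩
  exact Nat.le_zero.1 (h0 ▸ hμ.1 hi)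

theorem schur_eq_jacobiTrudi (n : ℕ) {N : ℕ} {μ : ℕ → ℕ} (hμ : IsPartition μ)
    (hN : partLen μ ≤ N) : schur n μ = jacobiTrudi n N μ := by
  induction N, hN using Nat.le_induction with
  | base => rfl
  | succ N hN ih => rw [ih, jacobiTrudi_succ (hμ.eq_zero hN)]

theorem mk_hsymm_eq_prod (n : ℕ) :
    PowerSeries.mk (hsymm (Fin n) ℚ) =
      ∏ i, PowerSeries.mk fun m => (X i : MvPolynomial (Fin n) ℚ) ^ m := by
  ext r κ
  have hmon (l : Fin n →₀ ℕ) : ∏ i, (X i : MvPolynomial (Fin n) ℚ) ^ l i = monomial l 1 := by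
    rw [monomial_eq, Finsupp.prod_fintype _ _ (by simp)]
    simp
  simp only [PowerSeries.coeff_mk, PowerSeries.coeff_prod, hmon, coeff_sum, coeff_monomial,
    coeff_hsymm, Finset.sum_ite_eq', Finset.mem_finsuppAntidiag, Finset.subset_univ, and_true,
    Finsupp.degree_eq_sum]

theorem mk_pow_mul_one_sub {R : Type*} [CommRing R] (x : R) :
    (PowerSeries.mk fun m => x ^ m) * (1 - PowerSeries.C x * PowerSeries.X) = 1 := by
  ext m
  cases m with
  | zero => simp [mul_sub]
  | succ m =>
    rw [mul_sub, mul_one, mul_left_comm, map_sub, PowerSeries.coeff_C_mul,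
      PowerSeries.coeff_succ_mul_X]
    simp [PowerSeries.coeff_one, pow_succ']

/-- The generating polynomial of the signed elementary symmetric polynomials in all variables
but the `j`-th one. -/
def signedElementary (n : ℕ) (j : Fin n) : Polynomial (MvPolynomial (Fin n) ℚ) :=
  ∏ i ∈ Finset.univ.erase j, (1 - Polynomial.C (X i) * Polynomial.X)

theorem coeff_signedElementary_of_le {n : ℕ} (j : Fin n) {b : ℕ} (hb : n ≤ b) :
    (signedElementary n j).coeff b = 0 := by
  apply Polynomial.coeff_eq_zero_of_natDegree_lt
  have h : (signedElementary n j).natDegree ≤ ∑ i ∈ Finset.univ.erase j, 1 := by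
    refine (Polynomial.natDegree_prod_le _ _).trans (Finset.sum_le_sum fun i _ => ?_)
    compute_degree
  rw [← Finset.card_eq_sum_ones, Finset.card_erase_of_mem (Finset.mem_univ j), Finset.card_univ,
    Fintype.card_fin] at h
  have := j.2
  omega

theorem mk_hsymm_mul_signedElementary {n : ℕ} (j : Fin n) :
    PowerSeries.mk (hsymm (Fin n) ℚ) * (signedElementary n j : PowerSeries (MvPolynomial (Fin n) ℚ))
      = PowerSeries.mk fun m => X j ^ m := by
  have hcast : (signedElementary n j : PowerSeries (MvPolynomial (Fin n) ℚ)) =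
      ∏ i ∈ Finset.univ.erase j, (1 - PowerSeries.C (X i) * PowerSeries.X) := by
    rw [signedElementary, ← Polynomial.coeToPowerSeries.ringHom_apply, map_prod]
    simp
  rw [mk_hsymm_eq_prod, hcast, ← Finset.mul_prod_erase _ _ (Finset.mem_univ j), mul_assoc,
    ← Finset.prod_mul_distrib, Finset.prod_congr rfl fun i _ => mk_pow_mul_one_sub _]
  simp

theorem X_pow_eq_sum_hInt {n : ℕ} (j : Fin n) (m : ℕ) :
    (X j : MvPolynomial (Fin n) ℚ) ^ m =
      ∑ b ∈ Finset.range n, hInt n ((m : ℤ) - b) * (signedElementary n j).coeff b := by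
  have h := congrArg (PowerSeries.coeff m) (mk_hsymm_mul_signedElementary j)
  rw [PowerSeries.coeff_mk, PowerSeries.coeff_mul, ← Finset.Nat.sum_antidiagonal_swap,
    Finset.Nat.sum_antidiagonal_eq_sum_range_succ_mk] at h
  rw [← h]
  have hl : ∀ b ∈ Finset.range (m + 1 + n), b ∉ Finset.range n →
      hInt n ((m : ℤ) - b) * (signedElementary n j).coeff b = 0 := by
    intro b _ hb
    rw [coeff_signedElementary_of_le j (by simpa using hb), mul_zero]
  have hr : ∀ b ∈ Finset.range (m + 1 + n), b ∉ Finset.range (m + 1) →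
      hInt n ((m : ℤ) - b) * (signedElementary n j).coeff b = 0 := by
    intro b _ hb
    rw [hInt_of_neg n (by simp at hb; omega), zero_mul]
  rw [Finset.sum_subset (Finset.range_mono (by omega)) hl,
    ← Finset.sum_subset (Finset.range_mono (by omega)) hr]
  refine Finset.sum_congr rfl fun b hb => ?_
  have hbm : b ≤ m := by simpa [Nat.lt_succ_iff] using hb
  simp [← Nat.cast_sub hbm, hInt_natCast]

/-- The exponent vector `μ + δ`. -/
def shiftedParts (n : ℕ) (μ : ℕ → ℕ) : Fin n →₀ ℕ :=
  Finsupp.equivFunOnFinite.symm fun i => μ i + (n - 1 - i)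

/-- The alternant with exponent vector `γ`. -/
def alternant {n : ℕ} (γ : Fin n →₀ ℕ) : MvPolynomial (Fin n) ℚ :=
  (Matrix.of fun i j : Fin n => (X j : MvPolynomial (Fin n) ℚ) ^ γ i).det

theorem alternant_shiftedParts_eq_mul (n : ℕ) (μ : ℕ → ℕ) :
    alternant (shiftedParts n μ) = jacobiTrudi n n μ *
      (Matrix.of fun k j : Fin n => (signedElementary n j).coeff (n - 1 - k)).det := by
  rw [jacobiTrudi, ← Matrix.det_mul, alternant]
  congr 1
  ext1 i j
  rw [Matrix.mul_apply, Matrix.of_apply, X_pow_eq_sum_hInt, Finset.sum_range,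
    ← Equiv.sum_comp Fin.revPerm]
  refine Finset.sum_congr rfl fun k _ => ?_
  have := i.2
  have := k.2
  simp only [Matrix.of_apply, Fin.revPerm_apply, Fin.val_rev, shiftedParts,
    Finsupp.equivFunOnFinite_symm_apply_apply]
  congr 2
  · omega
  · omega

theorem jacobiTrudi_zero (n N : ℕ) : jacobiTrudi n N 0 = 1 := by
  induction N with
  | zero => simp [jacobiTrudi]
  | succ N ih => rw [jacobiTrudi_succ (by rfl), ih]

theorem schur_mul_alternant {n : ℕ} {μ : ℕ → ℕ} (hμ : IsPartition μ) (h : partLen μ ≤ n) :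
    schur n μ * alternant (shiftedParts n 0) = alternant (shiftedParts n μ) := by
  rw [schur_eq_jacobiTrudi n hμ h, alternant_shiftedParts_eq_mul n μ,
    alternant_shiftedParts_eq_mul n 0, jacobiTrudi_zero, one_mul]

/-- A polynomial which changes under permutations of the variables by their sign. -/
def IsAlternating {n : ℕ} (p : MvPolynomial (Fin n) ℚ) : Prop :=
  ∀ e : Equiv.Perm (Fin n), rename e p = ((Equiv.Perm.sign e : ℤ) : ℚ) • p

theorem isAlternating_alternant {n : ℕ} (γ : Fin n →₀ ℕ) : IsAlternating (alternant γ) := by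
  intro e
  rw [alternant, AlgHom.map_det, smul_eq_C_mul, map_intCast, ← Matrix.det_permute']
  congr 1
  ext1 i j
  simp

theorem IsAlternating.symmetric_mul {n : ℕ} {f p : MvPolynomial (Fin n) ℚ}
    (hp : IsAlternating p) (hf : f.IsSymmetric) : IsAlternating (f * p) := by
  intro e
  rw [map_mul, hf e, hp e, mul_smul_comm]

theorem IsAlternating.smul {n : ℕ} {p : MvPolynomial (Fin n) ℚ}
    (hp : IsAlternating p) (c : ℚ) : IsAlternating (c • p) := by
  intro e
  rw [map_smul, hp e, smul_comm]

theorem IsAlternating.sum {n : ℕ} {ι : Type*} {s : Finset ι} {p : ι → MvPolynomial (Fin n) ℚ}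
    (hp : ∀ i ∈ s, IsAlternating (p i)) : IsAlternating (∑ i ∈ s, p i) := by
  intro e
  rw [map_sum, Finset.smul_sum]
  exact Finset.sum_congr rfl fun i hi => hp i hi e

theorem IsAlternating.coeff_mapDomain {n : ℕ} {p : MvPolynomial (Fin n) ℚ}
    (hp : IsAlternating p) (e : Equiv.Perm (Fin n)) (κ : Fin n →₀ ℕ) :
    coeff κ p = (Equiv.Perm.sign e : ℤ) * coeff (κ.mapDomain e) p := by
  rw [← coeff_rename_mapDomain e e.injective p κ, hp e, coeff_smul, smul_eq_mul]

theorem IsAlternating.coeff_eq_zero {n : ℕ} {p : MvPolynomial (Fin n) ℚ}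
    (hp : IsAlternating p) {κ : Fin n →₀ ℕ} (hκ : ¬ Function.Injective κ) : coeff κ p = 0 := by
  simp only [Function.Injective, not_forall] at hκ
  obtain ⟨i, j, hij, hne⟩ := hκ
  have h := hp.coeff_mapDomain (Equiv.swap i j) κ
  have hκ : κ.mapDomain (Equiv.swap i j) = κ := by
    ext x
    rw [Finsupp.mapDomain_equiv_apply, Equiv.symm_swap, Equiv.swap_apply_def]
    split_ifs with h1 h2 <;> simp [*]
  rw [hκ, Equiv.Perm.sign_swap hne] at h
  push_cast at h
  linarith

theorem IsAlternating.ext {n : ℕ} {p q : MvPolynomial (Fin n) ℚ} (hp : IsAlternating p)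
    (hq : IsAlternating q) (h : ∀ κ : Fin n →₀ ℕ, StrictAnti κ → coeff κ p = coeff κ q) :
    p = q := by
  ext κ
  by_cases hκ : Function.Injective κ
  · set e : Equiv.Perm (Fin n) := (Tuple.sort (OrderDual.toDual ∘ κ))⁻¹ with he
    rw [hp.coeff_mapDomain e κ, hq.coeff_mapDomain e κ, h]
    have hco : (κ.mapDomain e : Fin n → ℕ) = κ ∘ Tuple.sort (OrderDual.toDual ∘ κ) := by
      funext x
      rw [Finsupp.mapDomain_equiv_apply]
      rfl
    have hanti : Antitone (κ ∘ Tuple.sort (OrderDual.toDual ∘ κ)) :=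
      Tuple.monotone_sort (OrderDual.toDual ∘ κ)
    rw [hco]
    exact hanti.strictAnti_of_injective (hκ.comp (Equiv.injective _))
  · rw [hp.coeff_eq_zero hκ, hq.coeff_eq_zero hκ]

theorem alternant_eq_sum {n : ℕ} (γ : Fin n →₀ ℕ) :
    alternant γ = ∑ σ : Equiv.Perm (Fin n),
      monomial (Finsupp.equivFunOnFinite.symm fun i => γ (σ i))
        ((Equiv.Perm.sign σ : ℤ) : ℚ) := by
  rw [alternant, Matrix.det_apply']
  refine Finset.sum_congr rfl fun σ _ => ?_
  rw [monomial_eq, Finsupp.prod_fintype _ _ (by simp)]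
  simp

theorem coeff_alternant {n : ℕ} {γ κ : Fin n →₀ ℕ} (hγ : StrictAnti γ) (hκ : StrictAnti κ) :
    coeff κ (alternant γ) = if γ = κ then 1 else 0 := by
  have hσ (σ : Equiv.Perm (Fin n)) :
      (Finsupp.equivFunOnFinite.symm fun i => γ (σ i)) = κ ↔ σ = 1 ∧ γ = κ := by
    constructor
    · intro h
      have hf : γ ∘ σ = κ := by rw [← h]; rfl
      have hγκ : (γ : Fin n → ℕ) = κ := by
        rw [← hγ.range_inj hκ, ← hf, Set.range_comp, σ.surjective.range_eq, Set.image_univ]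
      refine ⟨?_, DFunLike.coe_injective hγκ⟩
      ext1 i
      exact hγ.injective (by rw [← hγκ] at hf; exact congrFun hf i)
    · rintro ⟨rfl, rfl⟩
      ext; simp
  simp only [alternant_eq_sum, coeff_sum, coeff_monomial, hσ]
  split_ifs with h
  · simp [h]
  · simp [h]

theorem strictAnti_shiftedParts (n : ℕ) {μ : ℕ → ℕ} (hμ : Antitone μ) :
    StrictAnti (shiftedParts n μ) := by
  intro i j hij
  have h1 : μ j ≤ μ i := hμ (by exact_mod_cast hij.le)
  have h2 : (i : ℕ) < j := hij
  have := j.2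
  simp only [shiftedParts, Finsupp.equivFunOnFinite_symm_apply_apply]
  omega

theorem shiftedParts_injOn (n : ℕ) :
    Set.InjOn (shiftedParts n) {μ | IsPartition μ ∧ partLen μ ≤ n} := by
  rintro μ ⟨hμ, hμn⟩ ν ⟨hν, hνn⟩ h
  funext i
  by_cases hi : i < n
  · have := DFunLike.congr_fun h ⟨i, hi⟩
    simpa [shiftedParts] using this
  · rw [hμ.eq_zero (by omega), hν.eq_zero (by omega)]

theorem exists_shiftedParts_eq {n : ℕ} {κ : Fin n →₀ ℕ} (hκ : StrictAnti κ) :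
    ∃ μ, (IsPartition μ ∧ partLen μ ≤ n) ∧ shiftedParts n μ = κ := by
  have hle (d : ℕ) : ∀ i : Fin n, (i : ℕ) + d + 1 = n → d ≤ κ i := by
    induction d with
    | zero => simp
    | succ d ih =>
      intro i hi
      have h1 := ih ⟨i + 1, by omega⟩ (by simp; omega)
      have h2 : κ ⟨i + 1, by omega⟩ < κ i := hκ (by rw [Fin.lt_def]; simp)
      omega
  refine ⟨fun i => if h : i < n then κ ⟨i, h⟩ - (n - 1 - i) else 0, ⟨⟨?_, n, ?_⟩, ?_⟩, ?_⟩
  · refine antitone_nat_of_succ_le fun i => ?_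
    by_cases hi : i + 1 < n
    · have h2 : κ ⟨i + 1, hi⟩ < κ ⟨i, by omega⟩ := hκ (by rw [Fin.lt_def]; simp)
      simp only [hi, (by omega : i < n), dif_pos]
      omega
    · simp [hi]
  · intro i hi
    simp [hi]
  · exact Nat.sInf_le (by simp)
  · ext i
    have := hle (n - 1 - i) i (by omega)
    simp [shiftedParts]
    omega

theorem finsum_schur_mul_alternant {n : ℕ} {c : (ℕ → ℕ) → ℚ} (hc : (Function.support c).Finite)
    (hP : ∀ μ, c μ ≠ 0 → IsPartition μ ∧ partLen μ ≤ n) :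
    (∑ᶠ μ, c μ • schur n μ) * alternant (shiftedParts n 0) =
      ∑ μ ∈ hc.toFinset, c μ • alternant (shiftedParts n μ) := by
  rw [finsum_eq_sum_of_support_subset (s := hc.toFinset), Finset.sum_mul]
  · refine Finset.sum_congr rfl fun μ hμ => ?_
    obtain ⟨h1, h2⟩ := hP μ (by simpa using hμ)
    rw [smul_mul_assoc, schur_mul_alternant h1 h2]
  · intro μ hμ
    simp only [Set.Finite.coe_toFinset, Function.mem_support] at hμ ⊢
    rintro h
    simp [h] at hμ

theorem coeff_finsum_schur_mul_alternant {n : ℕ} {c : (ℕ → ℕ) → ℚ}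
    (hc : (Function.support c).Finite)
    (hP : ∀ μ, c μ ≠ 0 → IsPartition μ ∧ partLen μ ≤ n) {α : ℕ → ℕ} (hα : IsPartition α)
    (hαn : partLen α ≤ n) :
    coeff (shiftedParts n α) ((∑ᶠ μ, c μ • schur n μ) * alternant (shiftedParts n 0)) = c α := by
  rw [finsum_schur_mul_alternant hc hP, coeff_sum, Finset.sum_eq_single α]
  · simp [coeff_alternant, strictAnti_shiftedParts n hα.1]
  · intro μ hμ hne
    have hμ' := hP μ (by simpa using hμ)
    rw [coeff_smul, coeff_alternant (strictAnti_shiftedParts n hμ'.1.1)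
      (strictAnti_shiftedParts n hα.1), if_neg, smul_zero]
    exact fun h => hne (shiftedParts_injOn n hμ' ⟨hα, hαn⟩ h)
  · intro h
    have : c α = 0 := by simpa using h
    simp [this]

theorem exists_schur_expansion {n : ℕ} {f : MvPolynomial (Fin n) ℚ} (hf : f.IsSymmetric) :
    ∃ c : (ℕ → ℕ) → ℚ, (Function.support c).Finite ∧
      (∀ μ, c μ ≠ 0 → IsPartition μ ∧ partLen μ ≤ n) ∧ f = ∑ᶠ μ, c μ • schur n μ := by
  classical
  set p := f * alternant (shiftedParts n 0) with hp
  have hpa : IsAlternating p := (isAlternating_alternant _).symmetric_mul hf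
  set c : (ℕ → ℕ) → ℚ := fun μ =>
    if IsPartition μ ∧ partLen μ ≤ n then coeff (shiftedParts n μ) p else 0 with hcdef
  have hP : ∀ μ, c μ ≠ 0 → IsPartition μ ∧ partLen μ ≤ n := by
    intro μ hμ
    by_contra h
    exact hμ (if_neg h)
  have hc : (Function.support c).Finite := by
    refine Set.Finite.of_finite_image (f := shiftedParts n)
      (p.support.finite_toSet.subset ?_) ((shiftedParts_injOn n).mono fun μ hμ => hP μ hμ)
    rintro _ ⟨μ, hμ, rfl⟩
    have h1 : c μ = coeff (shiftedParts n μ) p := if_pos (hP μ hμ)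
    simpa [← h1] using hμ
  have h0 : alternant (shiftedParts n 0) ≠ 0 := by
    intro h
    have h1 := coeff_alternant (strictAnti_shiftedParts n (μ := 0) antitone_const)
      (strictAnti_shiftedParts n (μ := 0) antitone_const)
    simp [h] at h1
  refine ⟨c, hc, hP, mul_right_cancel₀ h0 ?_⟩
  rw [← hp]
  refine hpa.ext ?_ fun κ hκ => ?_
  · rw [finsum_schur_mul_alternant hc hP]
    exact IsAlternating.sum fun μ _ => (isAlternating_alternant _).smul _
  · obtain ⟨μ, hμ, rfl⟩ := exists_shiftedParts_eq hκ
    rw [coeff_finsum_schur_mul_alternant hc hP hμ.1 hμ.2]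
    exact (if_pos hμ).symm

/-- The weight matrix governing the product of an alternant with hook Schur polynomials. -/
def weightMatrix {n : ℕ} {R : Type*} [CommRing R] (w : R) (γ θ : Fin n →₀ ℕ) :
    Matrix (Fin n) (Fin n) R :=
  Matrix.of fun i j => if θ j < γ i then w else if θ j = γ i then 1 else 0

theorem prod_weightMatrix {n : ℕ} {R : Type*} [CommRing R] (w : R) (γ θ : Fin n →₀ ℕ)
    (σ : Equiv.Perm (Fin n)) :
    ∏ i, weightMatrix w γ θ i (σ i) =
      if (Finsupp.equivFunOnFinite.symm fun i => θ (σ i)) ≤ γ then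
        w ^ (γ - Finsupp.equivFunOnFinite.symm fun i => θ (σ i)).support.card else 0 := by
  split_ifs with h
  · rw [← Finset.prod_const, ← Finset.prod_subset (Finset.subset_univ
      (γ - Finsupp.equivFunOnFinite.symm fun i => θ (σ i)).support)]
    · refine Finset.prod_congr rfl fun i hi => ?_
      have h1 : γ i - θ (σ i) ≠ 0 := by simpa using hi
      simp only [weightMatrix, Matrix.of_apply]
      rw [if_pos (by omega)]
    · intro i _ hi
      have h1 : γ i - θ (σ i) = 0 := by simpa [Nat.sub_eq_zero_iff_le] using hi
      have h2 : θ (σ i) ≤ γ i := h i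
      simp only [weightMatrix, Matrix.of_apply]
      rw [if_neg (by omega), if_pos (by omega)]
  · have h1 : ∃ i, ¬ θ (σ i) ≤ γ i := by
      by_contra! h1
      exact h h1
    obtain ⟨i, hi⟩ := h1
    refine Finset.prod_eq_zero (Finset.mem_univ i) ?_
    simp only [weightMatrix, Matrix.of_apply]
    rw [if_neg (by omega), if_neg (by omega)]

theorem coeff_alternant_mul_schur_hookParts {n a b c : ℕ} {γ θ : Fin n →₀ ℕ}
    (hdeg : γ.degree = θ.degree + (a + b + 1))
    (hdet : (weightMatrix (1 + Polynomial.X : Polynomial ℚ) γ θ).det =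
      (1 + Polynomial.X) * Polynomial.X ^ c) :
    coeff γ (alternant θ * schur n (hookParts (a + 1) (b + 1))) = if b = c then 1 else 0 := by
  set s : Equiv.Perm (Fin n) → Fin n →₀ ℕ :=
    fun σ => Finsupp.equivFunOnFinite.symm fun i => θ (σ i) with hs
  have hsub {σ : Equiv.Perm (Fin n)} (h : s σ ≤ γ) : (γ - s σ).degree = a + b + 1 := by
    have h1 : (s σ).degree = θ.degree := by
      rw [Finsupp.degree_eq_sum, Finsupp.degree_eq_sum]
      exact Equiv.sum_comp σ θ
    have h2 : (γ - s σ).degree + (s σ).degree = γ.degree := by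
      rw [← map_add, tsub_add_cancel_of_le h]
    omega
  set Q : Polynomial ℚ := ∑ σ : Equiv.Perm (Fin n), ((Equiv.Perm.sign σ : ℤ) : Polynomial ℚ) *
    if s σ ≤ γ then (1 + Polynomial.X) ^ ((γ - s σ).support.card - 1) else 0 with hQ
  have hne : (1 + Polynomial.X : Polynomial ℚ) ≠ 0 := by
    rw [add_comm]
    exact (Polynomial.monic_X_add_C (1 : ℚ)).ne_zero
  have hQX : Q = Polynomial.X ^ c := by
    apply mul_left_cancel₀ hne
    rw [← hdet, ← Matrix.det_transpose, Matrix.det_apply', hQ, Finset.mul_sum]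
    refine Finset.sum_congr rfl fun σ _ => ?_
    simp only [Matrix.transpose_apply]
    rw [prod_weightMatrix, mul_left_comm]
    congr 1
    split_ifs with h
    · have := card_support_pos (κ := γ - s σ) (by rw [hsub h]; omega)
      rw [← pow_succ', Nat.sub_add_cancel this]
    · simp
  have hcoeff : coeff γ (alternant θ * schur n (hookParts (a + 1) (b + 1))) = Q.coeff b := by
    rw [alternant_eq_sum, Finset.sum_mul, coeff_sum, hQ, Polynomial.finsetSum_coeff]
    refine Finset.sum_congr rfl fun σ _ => ?_
    rw [coeff_monomial_mul', ← Polynomial.C_eq_intCast, Polynomial.coeff_C_mul]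
    split_ifs with h
    · rw [coeff_schur_hookParts, if_pos (hsub h), Polynomial.coeff_one_add_X_pow]
    · simp
  rw [hcoeff, hQX, Polynomial.coeff_X_pow]

/-- The entries of a matrix whose first `m` rows are upper Hessenberg and whose other rows are
upper unitriangular. -/
def hessenbergEntry {R : Type*} [CommRing R] (w : R) (m i j : ℕ) : R :=
  if i < m then (if i ≤ j then w else if i = j + 1 then 1 else 0)
  else (if i < j then w else if i = j then 1 else 0)

theorem hessenbergEntry_succ {R : Type*} [CommRing R] (w : R) (m i j : ℕ) :
    hessenbergEntry w (m + 1) (i + 1) (j + 1) = hessenbergEntry w m i j := by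
  simp [hessenbergEntry]

theorem det_hessenberg_zero {R : Type*} [CommRing R] (w : R) (N : ℕ) :
    (Matrix.of fun i j : Fin N => hessenbergEntry w 0 i j).det = 1 := by
  rw [Matrix.det_of_isUpperTriangular]
  · simp [hessenbergEntry]
  · intro i j hij
    have : (j : ℕ) < i := hij
    simp only [hessenbergEntry, Matrix.of_apply]
    rw [if_neg (by omega), if_neg (by omega), if_neg (by omega)]

theorem det_hessenberg {R : Type*} [CommRing R] (w : R) {m N : ℕ} (hm : m ≤ N) :
    (Matrix.of fun i j : Fin (N + 1) => hessenbergEntry w (m + 1) i j).det = w * (w - 1) ^ m := by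
  induction m generalizing N with
  | zero =>
    rw [Matrix.det_succ_column_zero, Fin.sum_univ_succ, Finset.sum_eq_zero]
    · have h1 : (Matrix.of fun i j : Fin (N + 1) => hessenbergEntry w (0 + 1) i j).submatrix
          (Fin.succAbove 0) Fin.succ = Matrix.of fun i j : Fin N => hessenbergEntry w 0 i j := by
        ext1 i j
        simp only [Matrix.submatrix_apply, Matrix.of_apply, Fin.succAbove_zero, Fin.val_succ,
          hessenbergEntry_succ]
      rw [h1, det_hessenberg_zero]
      simp [hessenbergEntry]
    · intro i _
      simp [hessenbergEntry]
  | succ m ih =>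
    obtain ⟨N, rfl⟩ : ∃ M, N = M + 1 := ⟨N - 1, by omega⟩
    rw [Matrix.det_succ_column_zero, Fin.sum_univ_succ, Fin.sum_univ_succ, Finset.sum_eq_zero]
    · have h1 : (Matrix.of fun i j : Fin (N + 2) => hessenbergEntry w (m + 1 + 1) i j).submatrix
          (Fin.succAbove 0) Fin.succ =
          Matrix.of fun i j : Fin (N + 1) => hessenbergEntry w (m + 1) i j := by
        ext1 i j
        simp only [Matrix.submatrix_apply, Matrix.of_apply, Fin.succAbove_zero, Fin.val_succ,
          hessenbergEntry_succ]
      have h2 : (Matrix.of fun i j : Fin (N + 2) => hessenbergEntry w (m + 1 + 1) i j).submatrix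
          (Fin.succAbove (Fin.succ 0)) Fin.succ =
          Matrix.of fun i j : Fin (N + 1) => hessenbergEntry w (m + 1) i j := by
        ext1 i j
        cases i using Fin.cases with
        | zero => simp [hessenbergEntry]
        | succ i =>
          simp only [Matrix.submatrix_apply, Matrix.of_apply]
          rw [Fin.succAbove_of_le_castSucc _ _ (by rw [Fin.le_def]; simp)]
          exact hessenbergEntry_succ w (m + 1) (i + 1) j
      rw [h1, h2, ih (by omega)]
      simp [hessenbergEntry]
      ring
    · intro i _
      simp [hessenbergEntry]

/-- The parts of the partition `(k, k, 2^(l-2))`. -/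
def doubleHookParts (k l : ℕ) : ℕ → ℕ := fun i => if i < 2 then k else if i < l then 2 else 0

theorem degree_shiftedParts (n : ℕ) (μ : ℕ → ℕ) :
    (shiftedParts n μ).degree =
      ∑ i ∈ Finset.range n, μ i + ∑ i ∈ Finset.range n, (n - 1 - i) := by
  rw [Finsupp.degree_eq_sum, Finset.sum_range, Finset.sum_range, ← Finset.sum_add_distrib]
  rfl

theorem sum_hookParts {n k l : ℕ} (hl : l + 1 ≤ n) :
    ∑ i ∈ Finset.range n, hookParts k (l + 1) i = k + l := by
  induction n, hl using Nat.le_induction with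
  | base =>
    rw [Finset.sum_range_succ', Finset.sum_congr rfl (g := fun _ => 1)]
    · simp [hookParts, add_comm]
    · intro i hi
      simpa [hookParts] using hi
  | succ n hn ih =>
    rw [Finset.sum_range_succ, ih]
    simp only [hookParts]
    rw [if_neg (by omega), if_neg (by omega), add_zero]

theorem sum_doubleHookParts {n k l : ℕ} (hl : l + 2 ≤ n) :
    ∑ i ∈ Finset.range n, doubleHookParts k (l + 2) i = 2 * k + 2 * l := by
  induction n, hl using Nat.le_induction with
  | base =>
    rw [Finset.sum_range_succ', Finset.sum_range_succ', Finset.sum_congr rfl (g := fun _ => 2)]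
    · simp [doubleHookParts]
      ring
    · intro i hi
      simpa [doubleHookParts] using hi
  | succ n hn ih =>
    rw [Finset.sum_range_succ, ih]
    simp only [doubleHookParts]
    rw [if_neg (by omega), if_neg (by omega), add_zero]

theorem isPartition_hookParts (k l : ℕ) : IsPartition (hookParts (k + 1) (l + 1)) := by
  refine ⟨antitone_nat_of_succ_le fun i => ?_, l + 1, fun i hi => ?_⟩
  · rcases i with _ | i
    · simp [hookParts]
      split_ifs <;> omega
    · simp only [hookParts, if_neg (Nat.succ_ne_zero _)]
      split_ifs <;> omega
  · simp only [hookParts]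
    rw [if_neg (by omega), if_neg (by omega)]

theorem isPartition_doubleHookParts (k l : ℕ) : IsPartition (doubleHookParts (k + 2) (l + 2)) := by
  refine ⟨antitone_nat_of_succ_le fun i => ?_, l + 2, fun i hi => ?_⟩
  · simp only [doubleHookParts]
    split_ifs <;> omega
  · simp only [doubleHookParts]
    rw [if_neg (by omega), if_neg (by omega)]

theorem partLen_doubleHookParts (k l : ℕ) : partLen (doubleHookParts (k + 2) (l + 2)) = l + 2 := by
  apply partLen_eq
  · simp [doubleHookParts]
  · intro i hi
    simp only [doubleHookParts]
    split_ifs <;> omega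

theorem det_weightMatrix_arm {R : Type*} [CommRing R] (w : R) {n k l : ℕ} (hn : l + 3 ≤ n) :
    (weightMatrix w (shiftedParts n (doubleHookParts (k + 3) (l + 3)))
      (shiftedParts n (hookParts (k + 2) (l + 3)))).det = w * (w - 1) ^ (l + 2) := by
  obtain ⟨N, rfl⟩ : ∃ M, n = M + 1 := ⟨n - 1, by omega⟩
  rw [← det_hessenberg w (show l + 2 ≤ N by omega)]
  congr 1
  ext1 i j
  have := i.2
  have := j.2
  simp only [weightMatrix, hessenbergEntry, shiftedParts, doubleHookParts, hookParts,
    Matrix.of_apply, Finsupp.equivFunOnFinite_symm_apply_apply]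
  split_ifs <;> first | rfl | omega

set_option maxHeartbeats 1000000 in
theorem det_weightMatrix_of_first_column {R : Type*} [CommRing R] (w : R) {n k l l' : ℕ}
    (hn : l + 3 ≤ n) (hl : l' = l + 3 ∨ l' = l + 2) :
    (weightMatrix w (shiftedParts n (doubleHookParts (k + 3) (l + 3)))
      (shiftedParts n (hookParts (k + 3) l'))).det = w * (w - 1) ^ (l + 1) := by
  obtain ⟨N, rfl⟩ : ∃ M, n = M + 2 := ⟨n - 2, by omega⟩
  rw [Matrix.det_succ_column_zero, Fin.sum_univ_succ, Finset.sum_eq_zero]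
  · rw [← det_hessenberg w (show l + 1 ≤ N by omega)]
    have h1 : weightMatrix w (shiftedParts (N + 2) (doubleHookParts (k + 3) (l + 3)))
        (shiftedParts (N + 2) (hookParts (k + 3) l')) 0 0 = 1 := by
      simp [weightMatrix, shiftedParts, doubleHookParts, hookParts]
    rw [h1]
    simp only [Fin.val_zero, pow_zero, one_mul, add_zero]
    congr 1
    ext1 i j
    have := i.2
    have := j.2
    simp only [weightMatrix, hessenbergEntry, shiftedParts, doubleHookParts, hookParts,
      Matrix.of_apply, Finsupp.equivFunOnFinite_symm_apply_apply, Matrix.submatrix_apply,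
      Fin.succAbove_zero, Fin.val_succ]
    rcases hl with rfl | rfl <;> split_ifs <;> first | rfl | contradiction | omega
  · intro i _
    have h0 : weightMatrix w (shiftedParts (N + 2) (doubleHookParts (k + 3) (l + 3)))
        (shiftedParts (N + 2) (hookParts (k + 3) l')) i.succ 0 = 0 := by
      have := i.2
      simp only [weightMatrix, shiftedParts, doubleHookParts, hookParts,
        Matrix.of_apply, Finsupp.equivFunOnFinite_symm_apply_apply, Fin.val_succ, Fin.val_zero]
      rcases hl with rfl | rfl <;> split_ifs <;> first | rfl | contradiction | omega
    rw [h0]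
    simp

/-- The coefficient functional that reads off the coefficient of `s_α` for
`α = doubleHookParts (k + 3) (l + 3)`. -/
def doubleHookCoeff (n k l : ℕ) : MvPolynomial (Fin n) ℚ →ₗ[ℚ] ℚ :=
  lcoeff ℚ (shiftedParts n (doubleHookParts (k + 3) (l + 3))) ∘ₗ
    LinearMap.mulRight ℚ (alternant (shiftedParts n 0))

theorem doubleHookCoeff_apply (n k l : ℕ) (f : MvPolynomial (Fin n) ℚ) :
    doubleHookCoeff n k l f = coeff (shiftedParts n (doubleHookParts (k + 3) (l + 3)))
      (f * alternant (shiftedParts n 0)) := rfl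

theorem doubleHookCoeff_hook_mul_hook {n k l a b a' b' c : ℕ} (hn : l + 3 ≤ n) (hb' : b' + 1 ≤ n)
    (hdeg : a + b + (a' + b') + 2 = 2 * k + 2 * l + 8)
    (hdet : (weightMatrix (1 + Polynomial.X : Polynomial ℚ)
      (shiftedParts n (doubleHookParts (k + 3) (l + 3)))
      (shiftedParts n (hookParts (a' + 1) (b' + 1)))).det =
      (1 + Polynomial.X) * (1 + Polynomial.X - 1) ^ c) :
    doubleHookCoeff n k l (schur n (hookParts (a' + 1) (b' + 1)) *
      schur n (hookParts (a + 1) (b + 1))) = if b = c then 1 else 0 := by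
  rw [doubleHookCoeff_apply, mul_right_comm, schur_mul_alternant (isPartition_hookParts a' b')
    (by rw [partLen_hookParts]; exact hb')]
  rw [add_sub_cancel_left] at hdet
  refine coeff_alternant_mul_schur_hookParts ?_ hdet
  have h1 := sum_hookParts (k := a' + 1) hb'
  have h2 := sum_doubleHookParts (k := k + 3) (l := l + 1) (n := n) hn
  rw [degree_shiftedParts, degree_shiftedParts, h1, h2]
  omega

theorem derived_one_schur_hookParts (n k l : ℕ) :
    derived n 1 (schur n (hookParts (k + 3) (l + 3))) =
      ((n : ℚ) + k + 2) • schur n (hookParts (k + 2) (l + 3)) +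
        ((n : ℚ) - l - 2) • schur n (hookParts (k + 3) (l + 2)) := by
  rw [derived_one, sum_pderiv_schur_hookParts n (k + 1) (l + 1)]
  push_cast
  congr 2 <;> ring

theorem derived_two_schur_hookParts (n k l : ℕ) :
    derived n 2 (schur n (hookParts (k + 3) (l + 3))) =
      (1 / 2 : ℚ) • ((((n : ℚ) + k + 2) * (n + k + 1)) • schur n (hookParts (k + 1) (l + 3)) +
        (2 * ((n : ℚ) + k + 2) * (n - l - 2)) • schur n (hookParts (k + 2) (l + 2)) +
        (((n : ℚ) - l - 2) * (n - l - 1)) • schur n (hookParts (k + 3) (l + 1))) := by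
  rw [derived_two, sum_pderiv_schur_hookParts n (k + 1) (l + 1)]
  simp only [map_add, Derivation.map_smul, Finset.sum_add_distrib, ← Finset.smul_sum]
  have h1 := sum_pderiv_schur_hookParts n k (l + 1)
  have h2 := sum_pderiv_schur_hookParts n (k + 1) l
  simp only [add_assoc, Nat.reduceAdd] at h1 h2 ⊢
  rw [h1, h2]
  push_cast
  module

/-- The coefficient of `s_α` in `(s_λ^(1))^2 - s_λ s_λ^(2)`. -/
theorem doubleHookCoeff_derived {n k l : ℕ} (hn : l + 3 ≤ n) :
    doubleHookCoeff n k l (derived n 1 (schur n (hookParts (k + 3) (l + 3))) ^ 2 -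
      schur n (hookParts (k + 3) (l + 3)) *
        derived n 2 (schur n (hookParts (k + 3) (l + 3)))) =
      ((n : ℚ) + k + 2) * (k + l + 4) + ((n : ℚ) - l - 2) ^ 2 := by
  have hA := det_weightMatrix_arm (1 + Polynomial.X : Polynomial ℚ) (k := k) hn
  have hB := det_weightMatrix_of_first_column (1 + Polynomial.X : Polynomial ℚ) (k := k) hn
    (Or.inr rfl)
  have hC := det_weightMatrix_of_first_column (1 + Polynomial.X : Polynomial ℚ) (k := k) hn
    (Or.inl rfl)
  have e1 := doubleHookCoeff_hook_mul_hook (a := k + 1) (b := l + 2) hn hn (by omega) hA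
  have e2 := doubleHookCoeff_hook_mul_hook (a := k + 2) (b := l + 1) hn hn (by omega) hA
  have e3 := doubleHookCoeff_hook_mul_hook (a := k + 2) (b := l + 1) hn (by omega) (by omega) hB
  have e4 := doubleHookCoeff_hook_mul_hook (a := k) (b := l + 2) hn hn (by omega) hC
  have e5 := doubleHookCoeff_hook_mul_hook (a := k + 1) (b := l + 1) hn hn (by omega) hC
  have e6 := doubleHookCoeff_hook_mul_hook (a := k + 2) (b := l) hn hn (by omega) hC
  simp only [add_assoc, Nat.reduceAdd, Nat.reduceEqDiff, Nat.add_left_cancel_iff, if_true,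
    if_false] at e1 e2 e3 e4 e5 e6
  rw [if_neg (by omega)] at e6
  set p : ℚ := (n : ℚ) + k + 2 with hp
  set q : ℚ := (n : ℚ) - l - 2 with hq
  have expand : derived n 1 (schur n (hookParts (k + 3) (l + 3))) ^ 2 -
      schur n (hookParts (k + 3) (l + 3)) *
        derived n 2 (schur n (hookParts (k + 3) (l + 3))) =
      (p ^ 2) • (schur n (hookParts (k + 2) (l + 3)) * schur n (hookParts (k + 2) (l + 3))) +
      (2 * p * q) • (schur n (hookParts (k + 2) (l + 3)) * schur n (hookParts (k + 3) (l + 2))) +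
      (q ^ 2) • (schur n (hookParts (k + 3) (l + 2)) * schur n (hookParts (k + 3) (l + 2))) -
      (p * (n + k + 1) / 2) •
        (schur n (hookParts (k + 3) (l + 3)) * schur n (hookParts (k + 1) (l + 3))) -
      (p * q) • (schur n (hookParts (k + 3) (l + 3)) * schur n (hookParts (k + 2) (l + 2))) -
      (q * (n - l - 1) / 2) •
        (schur n (hookParts (k + 3) (l + 3)) * schur n (hookParts (k + 3) (l + 1))) := by
    rw [derived_one_schur_hookParts, derived_two_schur_hookParts, ← hp, ← hq]
    generalize schur n (hookParts (k + 3) (l + 3)) = s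
    generalize schur n (hookParts (k + 2) (l + 3)) = s₁
    generalize schur n (hookParts (k + 3) (l + 2)) = s₂
    generalize schur n (hookParts (k + 1) (l + 3)) = s₃
    generalize schur n (hookParts (k + 2) (l + 2)) = s₄
    generalize schur n (hookParts (k + 3) (l + 1)) = s₅
    simp only [pow_two, add_mul, mul_add, smul_mul_assoc, mul_smul_comm, smul_add, smul_smul]
    rw [mul_comm s₂ s₁]
    module
  rw [expand]
  simp only [map_add, map_sub, map_smul, e1, e2, e3, e4, e5, e6, smul_eq_mul]
  rw [hp, hq]
  ring

theorem isSymmetric_derived_sq_sub (n k l : ℕ) :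
    (derived n 1 (schur n (hookParts (k + 3) (l + 3))) ^ 2 -
      schur n (hookParts (k + 3) (l + 3)) *
        derived n 2 (schur n (hookParts (k + 3) (l + 3)))).IsSymmetric := by
  have h (μ) := isSymmetric_schur n μ
  rw [derived_one_schur_hookParts, derived_two_schur_hookParts, pow_two]
  have h₁ (a b : ℚ) (p q : MvPolynomial (Fin n) ℚ) (hp : p.IsSymmetric) (hq : q.IsSymmetric) :
      (a • p + b • q).IsSymmetric := (hp.smul a).add (hq.smul b)
  have h₂ := h₁ ((n : ℚ) + k + 2) ((n : ℚ) - l - 2) _ _ (h (hookParts (k + 2) (l + 3)))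
    (h (hookParts (k + 3) (l + 2)))
  exact (h₂.mul h₂).sub ((h _).mul (((h₁ _ _ _ _ (h _) (h _)).add ((h _).smul _)).smul _))

/-- for the hook `λ = (k, 1^(ℓ-1))` with `k, ℓ ≥ 3` and `n ≥ ℓ` variables,
the coefficient of `s_(k^2, 2^(ℓ-2))` in the (unique) Schur expansion of
`(s_λ^(1))^2 - s_λ * s_λ^(2)` (over partitions with at most `n` parts, whose Schur
polynomials form a basis) equals `(n + k - 1)(k + ℓ - 2) + (n + 1 - ℓ)^2`, which is
positive.  We record: such an expansion exists and has this coefficient, every such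
expansion has this coefficient, and the value is positive. -/
theorem hook_special_coefficient (k ℓ n : ℕ) (hk : 3 ≤ k) (hℓ : 3 ≤ ℓ) (hn : ℓ ≤ n) :
    (∃ c : (ℕ → ℕ) → ℚ, (Function.support c).Finite ∧
      (∀ μ, c μ ≠ 0 → IsPartition μ ∧ partLen μ ≤ n) ∧
      (derived n 1 (schur n fun i => if i = 0 then k else if i < ℓ then 1 else 0)) ^ 2 -
          schur n (fun i => if i = 0 then k else if i < ℓ then 1 else 0) *
            derived n 2 (schur n fun i => if i = 0 then k else if i < ℓ then 1 else 0) =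
        ∑ᶠ μ, c μ • schur n μ ∧
      c (fun i => if i < 2 then k else if i < ℓ then 2 else 0) =
        ((n : ℚ) + k - 1) * ((k : ℚ) + ℓ - 2) + ((n : ℚ) + 1 - ℓ) ^ 2) ∧
    (∀ c : (ℕ → ℕ) → ℚ, (Function.support c).Finite →
      (∀ μ, c μ ≠ 0 → IsPartition μ ∧ partLen μ ≤ n) →
      (derived n 1 (schur n fun i => if i = 0 then k else if i < ℓ then 1 else 0)) ^ 2 -
          schur n (fun i => if i = 0 then k else if i < ℓ then 1 else 0) *
            derived n 2 (schur n fun i => if i = 0 then k else if i < ℓ then 1 else 0) =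
        ∑ᶠ μ, c μ • schur n μ →
      c (fun i => if i < 2 then k else if i < ℓ then 2 else 0) =
        ((n : ℚ) + k - 1) * ((k : ℚ) + ℓ - 2) + ((n : ℚ) + 1 - ℓ) ^ 2) ∧
    0 < ((n : ℚ) + k - 1) * ((k : ℚ) + ℓ - 2) + ((n : ℚ) + 1 - ℓ) ^ 2 := by
  obtain ⟨k, rfl⟩ := Nat.exists_eq_add_of_le' hk
  obtain ⟨l, rfl⟩ := Nat.exists_eq_add_of_le' hℓ
  have hpos : 0 < ((n : ℚ) + (k + 3 : ℕ) - 1) * (((k + 3 : ℕ) : ℚ) + (l + 3 : ℕ) - 2) +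
      ((n : ℚ) + 1 - (l + 3 : ℕ)) ^ 2 := by
    have h : ((n : ℚ) + (k + 3 : ℕ) - 1) * (((k + 3 : ℕ) : ℚ) + (l + 3 : ℕ) - 2) =
        ((n : ℚ) + k + 2) * (k + l + 4) := by
      push_cast
      ring
    rw [h]
    positivity
  have hcoeff (c : (ℕ → ℕ) → ℚ) (hc : (Function.support c).Finite)
      (hP : ∀ μ, c μ ≠ 0 → IsPartition μ ∧ partLen μ ≤ n)
      (h : derived n 1 (schur n (hookParts (k + 3) (l + 3))) ^ 2 -
        schur n (hookParts (k + 3) (l + 3)) *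
          derived n 2 (schur n (hookParts (k + 3) (l + 3))) = ∑ᶠ μ, c μ • schur n μ) :
      c (doubleHookParts (k + 3) (l + 3)) =
        ((n : ℚ) + (k + 3 : ℕ) - 1) * (((k + 3 : ℕ) : ℚ) + (l + 3 : ℕ) - 2) +
          ((n : ℚ) + 1 - (l + 3 : ℕ)) ^ 2 := by
    rw [← coeff_finsum_schur_mul_alternant hc hP (isPartition_doubleHookParts (k + 1) (l + 1))
      (by rw [partLen_doubleHookParts]; exact hn), ← h]
    refine (doubleHookCoeff_derived hn).trans ?_
    push_cast
    ring
  obtain ⟨c, hc, hP, h⟩ := exists_schur_expansion (isSymmetric_derived_sq_sub n k l)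
  exact ⟨⟨c, hc, hP, h, hcoeff c hc hP h⟩, hcoeff, hpos⟩

end
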